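/- There is no differentiable function ψ̃ : ℝ² → ℝ whose partial derivatives satisfy ∂ψ̃/∂t¹(t¹,t²) = −(t¹)³(t²)²/6 and ∂ψ̃/∂t²(t¹,t²) = −(t¹)⁴t²/6 for all (t¹,t²) ∈ ℝ². -/

import Mathlib

/-- A function is determined up to a constant by its derivative. -/
theorem sub_eq_sub_of_hasDerivAt {f g f' : ℝ → ℝ} (hf : ∀ x, HasDerivAt f (f' x) x)
    (hg : ∀ x, HasDerivAt g (f' x) x) (a b : ℝ) : f b - f a = g b - g a := by
  have h : ∀ x, HasDerivAt (fun x => f x - g x) 0 x := fun x => by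
    simpa using (hf x).fun_sub (hg x)
  have := is_const_of_deriv_eq_zero (fun x => (h x).differentiableAt) (fun x => (h x).deriv) b a
  linarith

/-- There is no differentiable function ψ̃ : ℝ² → ℝ with
∂ψ̃/∂t¹(t¹,t²) = −(t¹)³(t²)²/6 and ∂ψ̃/∂t²(t¹,t²) = −(t¹)⁴t²/6 everywhere. -/
theorem no_potential_for_nonclosed_form :
    ¬ ∃ ψ : ℝ × ℝ → ℝ, Differentiable ℝ ψ ∧
      (∀ p : ℝ × ℝ, fderiv ℝ ψ p (1, 0) = -(p.1 ^ 3 * p.2 ^ 2) / 6) ∧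
      (∀ p : ℝ × ℝ, fderiv ℝ ψ p (0, 1) = -(p.1 ^ 4 * p.2) / 6) := by
  rintro ⟨ψ, hd, h1, h2⟩
  have horizontal : ∀ b : ℝ, ψ (1, b) - ψ (0, b) = -b ^ 2 / 24 := fun b => by
    have hf : ∀ x, HasDerivAt (fun x => ψ (x, b)) (-(x ^ 3 * b ^ 2) / 6) x := fun x => by
      have := (hd (x, b)).hasFDerivAt.comp_hasDerivAt x
        ((hasDerivAt_id x).prodMk (hasDerivAt_const x b))
      rwa [h1] at this
    have hg : ∀ x : ℝ, HasDerivAt (fun x => -b ^ 2 / 24 * x ^ 4) (-(x ^ 3 * b ^ 2) / 6) x :=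
      fun x => ((hasDerivAt_pow 4 x).const_mul (-b ^ 2 / 24)).congr_deriv (by push_cast; ring)
    simpa using sub_eq_sub_of_hasDerivAt hf hg 0 1
  have vertical : ∀ a : ℝ, ψ (a, 1) - ψ (a, 0) = -a ^ 4 / 12 := fun a => by
    have hf : ∀ y, HasDerivAt (fun y => ψ (a, y)) (-(a ^ 4 * y) / 6) y := fun y => by
      have := (hd (a, y)).hasFDerivAt.comp_hasDerivAt y
        ((hasDerivAt_const y a).prodMk (hasDerivAt_id y))
      rwa [h2] at this
    have hg : ∀ y : ℝ, HasDerivAt (fun y => -a ^ 4 / 12 * y ^ 2) (-(a ^ 4 * y) / 6) y :=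
      fun y => ((hasDerivAt_pow 2 y).const_mul (-a ^ 4 / 12)).congr_deriv (by push_cast; ring)
    simpa using sub_eq_sub_of_hasDerivAt hf hg 0 1
  linarith [horizontal 0, horizontal 1, vertical 0, vertical 1]
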